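/- Let p be a prime, let E be an elementary abelian p-group of order p^n acting faithfully by automorphisms on a finite nilpotent group Q of order coprime to p, and let G = Q ⋊ E be the corresponding semidirect product. Then the c-dimension of G is at least n. -/

import Mathlib

/-- The subgroup of elements of `Q` fixed by a subgroup `A` of a group acting on `Q`. -/
def fixedSubgroup {E Q : Type*} [Group E] [Group Q] (φ : E →* MulAut Q) (A : Subgroup E) :
    Subgroup Q where
  carrier := {x | ∀ a ∈ A, φ a x = x}
  one_mem' := by simp
  mul_mem' hx hy a ha := by rw [map_mul, hx a ha, hy a ha]
  inv_mem' hx a ha := by rw [map_inv, hx a ha]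

theorem mem_fixedSubgroup {E Q : Type*} [Group E] [Group Q] {φ : E →* MulAut Q}
    {A : Subgroup E} {x : Q} : x ∈ fixedSubgroup φ A ↔ ∀ a ∈ A, φ a x = x :=
  Iff.rfl

theorem fixedSubgroup_anti {E Q : Type*} [Group E] [Group Q] (φ : E →* MulAut Q)
    {A B : Subgroup E} (h : B ≤ A) : fixedSubgroup φ A ≤ fixedSubgroup φ B :=
  fun _ hx b hb => hx b (h hb)

theorem mem_fixedSubgroup_sup_zpowers {E Q : Type*} [Group E] [Group Q] {φ : E →* MulAut Q}
    {B : Subgroup E} {c : E} {x : Q} (hB : x ∈ fixedSubgroup φ B) (hc : φ c x = x) :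
    x ∈ fixedSubgroup φ (B ⊔ Subgroup.zpowers c) := by
  let S : Subgroup E := (MulAction.stabilizer (MulAut Q) x).comap φ
  have hS : B ⊔ Subgroup.zpowers c ≤ S :=
    sup_le (fun b hb => hB b hb) (Subgroup.zpowers_le.2 hc)
  exact fun a ha => hS ha

theorem apply_mem_fixedSubgroup {E Q : Type*} [CommGroup E] [Group Q] {φ : E →* MulAut Q}
    {B : Subgroup E} {x : Q} (hx : x ∈ fixedSubgroup φ B) (g : E) :
    φ g x ∈ fixedSubgroup φ B := fun b hb => by
  rw [← MulAut.mul_apply, ← map_mul, mul_comm, map_mul, MulAut.mul_apply, hx b hb]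

theorem pow_injective_of_coprime_card {Q : Type*} [Group Q] {p : ℕ}
    (hcop : (Nat.card Q).Coprime p) : Function.Injective fun x : Q => x ^ p :=
  (powCoprime hcop).injective

/-- An automorphism of order dividing `p` of a group of order coprime to `p` fixes `x`
as soon as it fixes the displacement of `x`. -/
theorem apply_eq_of_apply_displacement_eq {E Q : Type*} [Group E] [Group Q] {p : ℕ}
    (hcop : (Nat.card Q).Coprime p) (φ : E →* MulAut Q) {e : E} (he : e ^ p = 1) {x : Q}
    (h : φ e (x⁻¹ * φ e x) = x⁻¹ * φ e x) : φ e x = x := by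
  have key : ∀ k : ℕ, φ (e ^ k) x = x * (x⁻¹ * φ e x) ^ k := by
    intro k
    induction k with
    | zero => simp
    | succ k ih =>
      rw [pow_succ', map_mul, MulAut.mul_apply, ih, map_mul, map_pow, h, pow_succ', ← mul_assoc,
        mul_inv_cancel_left]
  have hp := key p
  rw [he, map_one, MulAut.one_apply, left_eq_mul] at hp
  have h1 : x⁻¹ * φ e x = 1 :=
    pow_injective_of_coprime_card hcop (by simpa only [one_pow] using hp)
  exact (inv_mul_eq_one.1 h1).symm

theorem prod_apply_pow_eq {E Q : Type*} [Group E] [CommGroup Q] {p : ℕ} (φ : E →* MulAut Q)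
    {e : E} (he : e ^ p = 1) (x : Q) :
    φ e (∏ j ∈ Finset.range p, φ (e ^ j) x) = ∏ j ∈ Finset.range p, φ (e ^ j) x := by
  rw [map_prod]
  simp_rw [← MulAut.mul_apply, ← map_mul, ← pow_succ']
  have h := (Finset.prod_range_succ' (fun j => φ (e ^ j) x) p).symm.trans
    (Finset.prod_range_succ (fun j => φ (e ^ j) x) p)
  rw [he, pow_zero] at h
  exact mul_right_cancel h

/-- If an elementary abelian `p`-group acts nontrivially on an abelian group of coprime order,
then some subgroup of corank at most one has more fixed points than the whole group. -/
theorem exists_fixedSubgroup_not_le_of_comm {E Q : Type*} [CommGroup E] [Finite E] [CommGroup Q]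
    {p : ℕ} (hp : p.Prime) (hexp : ∀ x : E, x ^ p = 1) (hcop : (Nat.card Q).Coprime p)
    (φ : E →* MulAut Q) (A : Subgroup E) (hA : fixedSubgroup φ A ≠ ⊤) :
    ∃ B ≤ A, ∃ b, B ⊔ Subgroup.zpowers b = A ∧ ¬ fixedSubgroup φ B ≤ fixedSubgroup φ A := by
  have hbot : ¬ fixedSubgroup φ ⊥ ≤ fixedSubgroup φ A := by
    refine fun h => hA (top_le_iff.1 (le_trans ?_ h))
    intro x _ a ha
    rw [Subgroup.mem_bot.1 ha, map_one, MulAut.one_apply]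
  obtain ⟨B, hmax⟩ := (Set.toFinite {B : Subgroup E | B ≤ A ∧
    ¬ fixedSubgroup φ B ≤ fixedSubgroup φ A}).exists_maximal ⟨⊥, bot_le, hbot⟩
  obtain ⟨hBA, hB⟩ := hmax.prop
  have hfix : ∀ c ∈ A, c ∉ B → ∀ x ∈ fixedSubgroup φ B, φ c x = x →
      x ∈ fixedSubgroup φ A := by
    intro c hcA hcB x hx hcx
    by_contra hxA
    have hmem := hmax.le_of_ge (y := B ⊔ Subgroup.zpowers c)
      ⟨sup_le hBA (Subgroup.zpowers_le.2 hcA),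
        fun h => hxA (h (mem_fixedSubgroup_sup_zpowers hx hcx))⟩ le_sup_left
    exact hcB (hmem (Subgroup.mem_sup_right (Subgroup.mem_zpowers c)))
  have hprod : ∀ c ∈ A, c ∉ B → ∀ x ∈ fixedSubgroup φ B,
      ∏ j ∈ Finset.range p, φ (c ^ j) x ∈ fixedSubgroup φ A := fun c hcA hcB x hx =>
    hfix c hcA hcB _ (prod_mem fun j _ => apply_mem_fixedSubgroup hx _)
      (prod_apply_pow_eq φ (hexp c) x)
  obtain ⟨b, hbA, hbB⟩ : ∃ b ∈ A, b ∉ B := by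
    by_contra! h
    exact hB (fixedSubgroup_anti φ h)
  refine ⟨B, hBA, b, ?_, hB⟩
  by_contra hne
  obtain ⟨a, haA, ha⟩ : ∃ a ∈ A, a ∉ B ⊔ Subgroup.zpowers b := by
    by_contra! h
    exact hne (le_antisymm (sup_le hBA (Subgroup.zpowers_le.2 hbA)) h)
  refine hB fun x hx => ?_
  have hab : ∀ i : ℕ, a * b ^ i ∉ B := fun i hi => ha <| by
    have := mul_mem (Subgroup.mem_sup_left (T := Subgroup.zpowers b) hi)
      (inv_mem (Subgroup.mem_sup_right (S := B) (pow_mem (Subgroup.mem_zpowers b) i)))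
    simpa using this
  -- the product of the norms of `x` along the lines spanned by the `a * b ^ i`
  have h1 : ∏ i ∈ Finset.range p, ∏ j ∈ Finset.range p, φ ((a * b ^ i) ^ j) x
      ∈ fixedSubgroup φ A :=
    prod_mem fun i _ => hprod _ (mul_mem haA (pow_mem hbA i)) (hab i) x hx
  have hbj : ∀ j ∈ Finset.range (p - 1), b ^ (j + 1) ∉ B := by
    intro j hj hmem
    have hj' : j + 1 < p := by have := Finset.mem_range.1 hj; omega
    have hco : (Nat.card (Subgroup.zpowers b)).Coprime (j + 1) := by
      rw [Nat.card_zpowers]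
      exact Nat.Coprime.coprime_dvd_left (orderOf_dvd_of_pow_eq_one (hexp b))
        (Nat.coprime_of_lt_prime (by omega) hj' hp)
    obtain ⟨y, hy⟩ := (powCoprime hco).surjective ⟨b, Subgroup.mem_zpowers b⟩
    obtain ⟨m, hm⟩ := Subgroup.mem_zpowers_iff.1 y.2
    have hy' : (y : E) ^ (j + 1) = b := congrArg Subtype.val hy
    rw [← hm, ← zpow_natCast, ← zpow_mul, mul_comm, zpow_mul, zpow_natCast] at hy'
    exact hbB (hy' ▸ zpow_mem hmem m)
  have h2 : ∏ j ∈ Finset.range (p - 1), ∏ i ∈ Finset.range p,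
      φ ((a * b ^ i) ^ (j + 1)) x ∈ fixedSubgroup φ A := by
    refine prod_mem fun j hj => ?_
    have := apply_mem_fixedSubgroup (hprod _ (pow_mem hbA (j + 1)) (hbj j hj) x hx) (a ^ (j + 1))
    rw [map_prod] at this
    simp_rw [← MulAut.mul_apply, ← map_mul] at this
    convert this using 5 with i
    rw [mul_pow, ← pow_mul, ← pow_mul, mul_comm i]
  have h3 : x ^ p ∈ fixedSubgroup φ A := by
    rw [Finset.prod_comm] at h1
    obtain ⟨q, rfl⟩ : ∃ q, p = q + 1 := ⟨p - 1, by have := hp.pos; omega⟩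
    rw [Finset.prod_range_succ'] at h1
    simpa using (mul_mem_cancel_left h2).1 h1
  exact fun c hc => pow_injective_of_coprime_card hcop (by
    simpa only [map_pow] using h3 c hc)

/-- If an elementary abelian `p`-group acts nontrivially on a nilpotent group of coprime order,
then some subgroup of corank at most one has more fixed points than the whole group. -/
theorem exists_fixedSubgroup_not_le {E Q : Type*} [CommGroup E] [Finite E] [Group Q]
    [Group.IsNilpotent Q]
    {p : ℕ} (hp : p.Prime) (hexp : ∀ x : E, x ^ p = 1) (hcop : (Nat.card Q).Coprime p)
    (φ : E →* MulAut Q) (A : Subgroup E) (hA : fixedSubgroup φ A ≠ ⊤) :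
    ∃ B ≤ A, ∃ b, B ⊔ Subgroup.zpowers b = A ∧ ¬ fixedSubgroup φ B ≤ fixedSubgroup φ A := by
  revert φ hA hcop
  refine Group.nilpotent_center_quotient_ind (P := fun Q _ _ => (Nat.card Q).Coprime p →
    ∀ φ : E →* MulAut Q, fixedSubgroup φ A ≠ ⊤ → ∃ B ≤ A, ∃ b, B ⊔ Subgroup.zpowers b = A ∧
      ¬ fixedSubgroup φ B ≤ fixedSubgroup φ A) Q ?_ ?_
  · exact fun Q _ _ _ φ hA => absurd (Subsingleton.elim _ _) hA
  · intro Q _ _ ih hcop φ hA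
    let ψ : E →* MulAut (Subgroup.center Q) :=
      { toFun := fun e => Subgroup.centerCongr (φ e)
        map_one' := by rw [map_one]; rfl
        map_mul' := fun a b => by rw [map_mul]; rfl }
    by_cases hψ : fixedSubgroup ψ A = ⊤
    · let χ : E →* MulAut (Q ⧸ Subgroup.center Q) :=
        { toFun := fun e => QuotientGroup.congr _ _ (φ e)
            (Subgroup.characteristic_iff_map_eq.1 inferInstance (φ e))
          map_one' := by
            ext x
            induction x using QuotientGroup.induction_on
            simp
          map_mul' := fun a b => by
            ext x
            induction x using QuotientGroup.induction_on
            rw [map_mul]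
            rfl }
      have hχ : ∀ a ∈ A, ∀ x : Q, χ a x = x → φ a x = x := by
        intro a ha x hx
        have hz : x⁻¹ * φ a x ∈ Subgroup.center Q := QuotientGroup.eq.1 hx.symm
        refine apply_eq_of_apply_displacement_eq hcop φ (hexp a) ?_
        have : (⟨_, hz⟩ : Subgroup.center Q) ∈ fixedSubgroup ψ A := hψ ▸ Subgroup.mem_top _
        exact congrArg Subtype.val (this a ha)
      obtain ⟨B, hBA, b, hb, hB⟩ := ih
        (hcop.coprime_dvd_left (Subgroup.card_quotient_dvd_card _)) χ (by
          refine fun h => hA (top_le_iff.1 fun x _ a ha => hχ a ha x ?_)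
          have : (x : Q ⧸ Subgroup.center Q) ∈ fixedSubgroup χ A := h ▸ Subgroup.mem_top _
          exact this a ha)
      refine ⟨B, hBA, b, hb, fun h => hB fun y hy => ?_⟩
      induction y using QuotientGroup.induction_on with
      | H x =>
        have hx : x ∈ fixedSubgroup φ A := h fun c hc => hχ c (hBA hc) x (hy c hc)
        exact fun a ha => congrArg (QuotientGroup.mk (s := Subgroup.center Q)) (hx a ha)
    · open scoped IsMulCommutative in
      obtain ⟨B, hBA, b, hb, hB⟩ := exists_fixedSubgroup_not_le_of_comm
        (Q := Subgroup.center Q) hp hexp (hcop.coprime_dvd_left (Subgroup.card_subgroup_dvd_card _)) ψ A hψ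
      refine ⟨B, hBA, b, hb, fun h => hB fun y hy => ?_⟩
      have hy' : (y : Q) ∈ fixedSubgroup φ A := h fun c hc => congrArg Subtype.val (hy c hc)
      exact fun a ha => Subtype.ext (hy' a ha)

open SemidirectProduct in
theorem inl_mem_centralizer_inr_image_iff {E Q : Type*} [Group E] [Group Q] {φ : E →* MulAut Q}
    {A : Subgroup E} {x : Q} :
    inl x ∈ Subgroup.centralizer ((inr : E →* Q ⋊[φ] E) '' A) ↔ x ∈ fixedSubgroup φ A := by
  simp only [Subgroup.mem_centralizer_iff, Set.forall_mem_image, SetLike.mem_coe,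
    mem_fixedSubgroup]
  refine forall₂_congr fun a _ => ?_
  rw [← (inl_injective (φ := φ)).eq_iff, inl_aut, map_inv, mul_inv_eq_iff_eq_mul]

open SemidirectProduct in
theorem exists_strictMono_centralizer {E Q : Type*} [CommGroup E] [Finite E] [Group Q]
    [Group.IsNilpotent Q]
    {p : ℕ} (hp : p.Prime) (hexp : ∀ x : E, x ^ p = 1) (hcop : (Nat.card Q).Coprime p)
    (φ : E →* MulAut Q) (hφ : Function.Injective φ) (k : ℕ) (A : Subgroup E)
    (hA : p ^ k ≤ Nat.card A) :
    ∃ X : Fin (k + 1) → Set (Q ⋊[φ] E), (StrictMono fun i => Subgroup.centralizer (X i)) ∧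
      Subgroup.centralizer ((inr : E →* Q ⋊[φ] E) '' A) ≤ Subgroup.centralizer (X 0) := by
  induction k generalizing A with
  | zero => exact ⟨fun _ => inr '' A, Subsingleton.strictMono (α := Fin 1) _, le_rfl⟩
  | succ k ih =>
    have hne : fixedSubgroup φ A ≠ ⊤ := by
      intro h
      have hbot : A = ⊥ := (Subgroup.eq_bot_iff_forall A).2 fun a ha => hφ <| by
        ext x
        have hx : x ∈ fixedSubgroup φ A := h ▸ Subgroup.mem_top x
        simpa using hx a ha
      rw [hbot, Subgroup.card_bot] at hA
      exact absurd hA (not_le.2 (Nat.one_lt_pow (by omega) hp.one_lt))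
    obtain ⟨B, hBA, b, hb, hB⟩ := exists_fixedSubgroup_not_le hp hexp hcop φ A hne
    have hcard : Nat.card A ≤ Nat.card B * p := by
      have h := Set.natCard_mul_le (s := (B : Set E)) (t := Subgroup.zpowers b)
      rw [← Subgroup.mul_normal, hb] at h
      refine h.trans (Nat.mul_le_mul_left _ ?_)
      exact (Nat.card_zpowers b).trans_le (orderOf_le_of_pow_eq_one hp.pos (hexp b))
    obtain ⟨X, hX, hX0⟩ := ih B (Nat.le_of_mul_le_mul_right
      ((pow_succ p k).symm.trans_le (hA.trans hcard)) hp.pos)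
    refine ⟨Matrix.vecCons (inr '' A) X, ?_, le_rfl⟩
    have hlt : Subgroup.centralizer ((inr : E →* Q ⋊[φ] E) '' A) < Subgroup.centralizer (X 0) := by
      refine lt_of_lt_of_le (lt_of_le_not_ge
        (Subgroup.centralizer_le (Set.image_mono hBA)) fun h => hB fun x hx => ?_) hX0
      exact inl_mem_centralizer_inr_image_iff.1 (h (inl_mem_centralizer_inr_image_iff.2 hx))
    refine Fin.strictMono_iff_lt_succ.2 fun i => ?_
    cases i using Fin.cases with
    | zero => exact hlt
    | succ i => exact hX i.castSucc_lt_succ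

/-- Let `p` be a prime, let `E` be an elementary abelian `p`-group of order `p^n` acting
faithfully by automorphisms on a finite nilpotent group `Q` of order coprime to `p`, and
let `G = Q ⋊ E` be the corresponding semidirect product. Then the `c`-dimension of `G` is
at least `n`: there is a strict chain of centralizers
`C_G(X_0) < C_G(X_1) < ... < C_G(X_n)` of subsets `X_i` of `G`. -/
theorem cdim_semidirectProduct_ge
    (p : ℕ) (hp : p.Prime) (n : ℕ) (E Q : Type*) [CommGroup E] [Group Q] [Finite Q]
    (hexp : ∀ x : E, x ^ p = 1) (hcard : Nat.card E = p ^ n)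
    (hnilp : Group.IsNilpotent Q) (hcop : Nat.Coprime (Nat.card Q) p)
    (φ : E →* MulAut Q) (hfaithful : Function.Injective φ) :
    ∃ X : Fin (n + 1) → Set (Q ⋊[φ] E),
      StrictMono fun i => Subgroup.centralizer (X i) := by
  have : Finite E := Nat.finite_of_card_ne_zero (hcard ▸ (pow_pos hp.pos n).ne')
  obtain ⟨X, hX, -⟩ := exists_strictMono_centralizer hp hexp hcop φ hfaithful n ⊤
    (by rw [Subgroup.card_top, hcard])
  exact ⟨X, hX⟩
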